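/- Let A₁,…,Aₙ be pairwise commuting generators of C₀-semigroups T₁,…,Tₙ on a complex Banach space X with ‖Tⱼ(t)‖ ≤ M (M ≥ 1) for all t ≥ 0 and all j. Then for every ψ ∈ T_n and every nonzero x ∈ D(A), ‖ψ(A)x‖ ≤ −n·K_M·M^{n−1}·ψ(−‖A₁x‖/(n‖x‖), …, −‖Aₙx‖/(n‖x‖))·‖x‖, where K_M = (M+1)/(1 − e^{−(M+1)/M}). -/

import Mathlib

open MeasureTheory Filter Topology

noncomputable section

/-- A (one-parameter) `C₀`-semigroup of bounded operators on `X`. -/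
def IsC0Semigroup {X : Type*} [NormedAddCommGroup X] [NormedSpace ℂ X]
    (T : ℝ → X →L[ℂ] X) : Prop :=
  T 0 = 1 ∧ (∀ s t : ℝ, 0 ≤ s → 0 ≤ t → T (s + t) = T s ∘L T t) ∧
    ∀ x : X, Tendsto (fun t => T t x) (𝓝[≥] (0 : ℝ)) (𝓝 x)

/-- `InGenDomain T x y` means `x` belongs to the domain of the infinitesimal generator `A`
of the semigroup `T` and `A x = y`. -/
def InGenDomain {X : Type*} [NormedAddCommGroup X] [NormedSpace ℂ X]
    (T : ℝ → X →L[ℂ] X) (x y : X) : Prop :=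
  Tendsto (fun t : ℝ => t⁻¹ • (T t x - x)) (𝓝[>] (0 : ℝ)) (𝓝 y)

/-- The `n`-parameter semigroup `T(u) = T₁(u₁) ⋯ Tₙ(uₙ)`. -/
def Tprod {X : Type*} [NormedAddCommGroup X] [NormedSpace ℂ X] {n : ℕ}
    (T : Fin n → ℝ → X →L[ℂ] X) (u : Fin n → ℝ) : X →L[ℂ] X :=
  (List.ofFn fun j => T j (u j)).prod

/-- The open negative orthant `(-∞,0)ⁿ`. -/
def negOrthant (n : ℕ) : Set (Fin n → ℝ) := {s | ∀ j, s j < 0}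

/-- The closed nonpositive orthant `(-∞,0]ⁿ`. -/
def nonposOrthant (n : ℕ) : Set (Fin n → ℝ) := {s | ∀ j, s j ≤ 0}

/-- A function of `n` variables is absolutely monotone on `(-∞,0)ⁿ` if it is nonnegative
together with all its iterated partial derivatives there. -/
def AbsMonotoneOn (n : ℕ) (f : (Fin n → ℝ) → ℝ) : Prop :=
  ∀ (k : ℕ) (v : Fin k → Fin n) (s : Fin n → ℝ), s ∈ negOrthant n →
    0 ≤ iteratedFDerivWithin ℝ k f (negOrthant n) s (fun i => Pi.single (v i) 1)

/-- Membership in the class `𝒯ₙ` of (negative) Bernstein functions of `n` variables: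
`ψ` is a nonpositive `C^∞`-function on `(-∞,0)ⁿ` all of whose first-order partial
derivatives are absolutely monotone. -/
def MemTn (n : ℕ) (ψ : (Fin n → ℝ) → ℝ) : Prop :=
  ContDiffOn ℝ (⊤ : ℕ∞) ψ (negOrthant n) ∧ (∀ s ∈ negOrthant n, ψ s ≤ 0) ∧
    ∀ j : Fin n, AbsMonotoneOn n
      (fun s => fderivWithin ℝ ψ (negOrthant n) s (Pi.single j 1))

/-- The Lévy–Khintchine type representation
`ψ(s) = c₀ + c₁·s + ∫ (e^{s·u} - 1) dμ(u)` of a Bernstein function of `n` variables,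
where `c₀ ≤ 0`, `c₁ ∈ ℝ₊ⁿ` and `μ` is a positive measure on `ℝ₊ⁿ \ {0}`. -/
def HasLevyRep (n : ℕ) (ψ : (Fin n → ℝ) → ℝ) (c₀ : ℝ) (c₁ : Fin n → ℝ)
    (μ : Measure (Fin n → ℝ)) : Prop :=
  c₀ ≤ 0 ∧ (∀ j, 0 ≤ c₁ j) ∧ μ {u | ¬ ((∀ j, 0 ≤ u j) ∧ u ≠ 0)} = 0 ∧
    (∀ s ∈ negOrthant n, Integrable (fun u => Real.exp (∑ j, s j * u j) - 1) μ) ∧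
    ∀ s ∈ negOrthant n, ψ s = c₀ + ∑ j, c₁ j * s j +
      ∫ u, (Real.exp (∑ j, s j * u j) - 1) ∂μ

/-- The family of bounded positive measures `ν_t` on `ℝ₊ⁿ` with
`∫ e^{s·u} dν_t(u) = e^{t ψ(s)}` (multidimensional Bernstein–Widder). -/
def IsSubordinator (n : ℕ) (ψ : (Fin n → ℝ) → ℝ) (ν : ℝ → Measure (Fin n → ℝ)) : Prop :=
  ∀ t : ℝ, 0 ≤ t → IsFiniteMeasure (ν t) ∧ (ν t) {u | ¬ ∀ j, 0 ≤ u j} = 0 ∧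
    ∀ s ∈ negOrthant n, ∫ u, Real.exp (∑ j, s j * u j) ∂(ν t) = Real.exp (t * ψ s)

/-- The holomorphic (complex) extension `ψ(λ) = c₀ + c₁·λ + ∫ (e^{λ·u} - 1) dμ(u)`
of a Bernstein function with representation `(c₀, c₁, μ)` to `{Re λ ≤ 0} ⊆ ℂⁿ`. -/
def psiC (n : ℕ) (c₀ : ℝ) (c₁ : Fin n → ℝ) (μ : Measure (Fin n → ℝ))
    (l : Fin n → ℂ) : ℂ :=
  (c₀ : ℂ) + ∑ j, (c₁ j : ℂ) * l j +
    ∫ u, (Complex.exp (∑ j, l j * (u j : ℂ)) - 1) ∂μ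

/-- The joint point spectrum of the tuple of generators of the semigroups `T j`. -/
def JointPointSpectrum {X : Type*} [NormedAddCommGroup X] [NormedSpace ℂ X] {n : ℕ}
    (T : Fin n → ℝ → X →L[ℂ] X) : Set (Fin n → ℂ) :=
  {l | ∃ x : X, x ≠ 0 ∧ ∀ j, InGenDomain (T j) x (l j • x)}

/-- The joint approximate point spectrum of the tuple of generators of the `T j`. -/
def JointApproxSpectrum {X : Type*} [NormedAddCommGroup X] [NormedSpace ℂ X] {n : ℕ}
    (T : Fin n → ℝ → X →L[ℂ] X) : Set (Fin n → ℂ) :=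
  {l | ∃ (x : ℕ → X) (y : Fin n → ℕ → X), (∀ m, ‖x m‖ = 1) ∧
    (∀ j m, InGenDomain (T j) (x m) (y j m)) ∧
    ∀ j, Tendsto (fun m => ‖y j m - l j • x m‖) atTop (𝓝 0)}

/-- The joint residual spectrum of the tuple of generators of the `T j`:
those `λ ∈ ℂⁿ` for which `Σⱼ Im (λⱼ - Aⱼ)` is not dense in `X`. -/
def JointResidualSpectrum {X : Type*} [NormedAddCommGroup X] [NormedSpace ℂ X] {n : ℕ}
    (T : Fin n → ℝ → X →L[ℂ] X) : Set (Fin n → ℂ) :=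
  {l | ¬ Dense (↑(Submodule.span ℂ
      (⋃ j, {z : X | ∃ x y, InGenDomain (T j) x y ∧ z = l j • x - y})) : Set X)}

/-- The point spectrum of a (possibly unbounded) operator given by its graph
relation `R x y ↔ (x ∈ D(B) ∧ B x = y)`. -/
def PointSpec {X : Type*} [NormedAddCommGroup X] [NormedSpace ℂ X]
    (R : X → X → Prop) : Set ℂ :=
  {α | ∃ x : X, x ≠ 0 ∧ R x (α • x)}

/-- The approximate point spectrum of an operator given by its graph relation. -/
def ApproxSpec {X : Type*} [NormedAddCommGroup X] [NormedSpace ℂ X]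
    (R : X → X → Prop) : Set ℂ :=
  {α | ∃ x y : ℕ → X, (∀ m, ‖x m‖ = 1) ∧ (∀ m, R (x m) (y m)) ∧
    Tendsto (fun m => ‖y m - α • x m‖) atTop (𝓝 0)}

/-- The residual spectrum of an operator given by its graph relation:
those `α` for which `Im (α - B)` is not dense. -/
def ResidualSpec {X : Type*} [NormedAddCommGroup X] [NormedSpace ℂ X]
    (R : X → X → Prop) : Set ℂ :=
  {α | ¬ Dense (↑(Submodule.span ℂ {z : X | ∃ x y, R x y ∧ z = α • x - y}) : Set X)}

/-- The resolvent set of a closed operator given by its graph relation: `α` such that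
`α - B : D(B) → X` has a bounded everywhere-defined inverse. -/
def ResolventSet {X : Type*} [NormedAddCommGroup X] [NormedSpace ℂ X]
    (R : X → X → Prop) : Set ℂ :=
  {α | ∃ Rv : X →L[ℂ] X, (∀ z : X, R (Rv z) (α • Rv z - z)) ∧
    ∀ x y : X, R x y → Rv (α • x - y) = x}

/-- The constant `K_M = (M+1)/(1 - e^{-(M+1)/M})` from the moment inequality. -/
def KM (M : ℝ) : ℝ := (M + 1) / (1 - Real.exp (-(M + 1) / M))

/-- The open sector `{z ≠ 0 : |arg z| < θ}` in `ℂ`. -/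
def Sector (θ : ℝ) : Set ℂ := {z | z ≠ 0 ∧ |Complex.arg z| < θ}

/-- A `C₀`-semigroup is holomorphic if it extends to a holomorphic semigroup on some
open sector around the positive half axis, strongly continuous at `0` in the sector. -/
def IsHolomorphicSemigroup {X : Type*} [NormedAddCommGroup X] [NormedSpace ℂ X]
    (T : ℝ → X →L[ℂ] X) : Prop :=
  ∃ (θ : ℝ) (S : ℂ → X →L[ℂ] X), 0 < θ ∧ (∀ t : ℝ, 0 < t → S t = T t) ∧
    (∀ z w : ℂ, z ∈ Sector θ → w ∈ Sector θ → S (z + w) = S z ∘L S w) ∧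
    DifferentiableOn ℂ S (Sector θ) ∧
    ∀ x : X, Tendsto (fun z => S z x) (𝓝[Sector θ] 0) (𝓝 x)

end
lemma aux_lip {X : Type*} [NormedAddCommGroup X] [NormedSpace ℂ X]
    (T : ℝ → X →L[ℂ] X) (M : ℝ) (hT : IsC0Semigroup T) (hM : ∀ t, 0 ≤ t → ‖T t‖ ≤ M)
    (x y : X) (hy : InGenDomain T x y) (t : ℝ) (ht : 0 ≤ t) :
    ‖T t x - x‖ ≤ M * (t * ‖y‖) := by
  rcases ht.eq_or_lt with rfl | ht
  · simp [hT.1]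
  have hstep : ∀ (h : ℝ), 0 ≤ h → ∀ N : ℕ, ‖T (N * h) x - x‖ ≤ N * (M * ‖T h x - x‖) := by
    intro h hh N
    induction N with
    | zero => simp [hT.1]
    | succ N ih =>
      have h1 : T ((N + 1 : ℕ) * h) x - x = T (N * h) (T h x - x) + (T (N * h) x - x) := by
        have : ((N + 1 : ℕ) : ℝ) * h = N * h + h := by push_cast; ring
        rw [this, hT.2.1 _ _ (by positivity) hh]
        simp
      rw [h1]
      refine (norm_add_le _ _).trans ?_
      have h2 := (T (N * h)).le_of_opNorm_le (hM (N * h) (by positivity)) (T h x - x)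
      push_cast
      linarith
  have hlim : Tendsto (fun N : ℕ => t / ((N : ℝ) + 1)) atTop (𝓝[>] 0) := by
    refine tendsto_nhdsWithin_iff.2 ⟨?_, Eventually.of_forall fun N => ?_⟩
    · have := (tendsto_one_div_add_atTop_nhds_zero_nat (𝕜 := ℝ)).const_mul t
      simpa [div_eq_mul_inv] using this
    · rw [Set.mem_Ioi]
      positivity
  have h3 := ((Tendsto.comp hy hlim).norm.const_mul t).const_mul M
  refine (ge_of_tendsto' h3 fun N => ?_).trans_eq (by ring)
  have hN : (0 : ℝ) < (N : ℝ) + 1 := by positivity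
  have h4 := hstep (t / ((N : ℝ) + 1)) (by positivity) (N + 1)
  have h5 : ((N + 1 : ℕ) : ℝ) * (t / ((N : ℝ) + 1)) = t := by push_cast; field_simp
  rw [h5] at h4
  refine h4.trans_eq ?_
  simp only [Function.comp, norm_smul, norm_inv, Real.norm_eq_abs,
    abs_of_pos (div_pos ht hN)]
  push_cast
  field_simp

lemma aux_prod {X : Type*} [NormedAddCommGroup X] [NormedSpace ℂ X] (M : ℝ) (hM1 : 1 ≤ M) (x : X) :
    ∀ (n : ℕ) (A : Fin n → X →L[ℂ] X) (b : Fin n → ℝ), (∀ j, ‖A j‖ ≤ M) →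
      (∀ j, ‖A j x - x‖ ≤ b j) → M * ‖(List.ofFn A).prod x - x‖ ≤ M ^ n * ∑ j, b j := by
  intro n
  induction n with
  | zero => intro A b _ _; simp
  | succ n ih =>
    intro A b hA hb
    have h1 := ih (fun j => A j.succ) (fun j => b j.succ) (fun j => hA _) (fun j => hb _)
    rw [List.ofFn_succ, List.prod_cons, Fin.sum_univ_succ]
    set P := (List.ofFn fun j : Fin n => A j.succ).prod
    have h2 : (A 0 * P) x - x = A 0 (P x - x) + (A 0 x - x) := by simp
    have h3 := (A 0).le_of_opNorm_le (hA 0) (P x - x)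
    have h4 := norm_add_le (A 0 (P x - x)) (A 0 x - x)
    have h5 := hb 0
    have hb0 : 0 ≤ b 0 := (norm_nonneg _).trans h5
    have h6 : M * b 0 ≤ M ^ (n + 1) * b 0 := by
      gcongr
      exact le_self_pow₀ hM1 (by omega)
    rw [h2]
    have h7 : ‖A 0 (P x - x) + (A 0 x - x)‖ ≤ M ^ n * ∑ j : Fin n, b j.succ + b 0 := by linarith
    calc _ ≤ M * (M ^ n * ∑ j : Fin n, b j.succ + b 0) := by gcongr
      _ ≤ _ := by rw [mul_add M, mul_add (M ^ (n+1)), pow_succ] at *; linarith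

lemma KM_den (M : ℝ) (hM1 : 1 ≤ M) : 0 < 1 - Real.exp (-(M + 1) / M) := by
  have : -(M + 1) / M < 0 := by apply div_neg_of_neg_of_pos <;> linarith
  have := Real.exp_lt_one_iff.2 this
  linarith

lemma KM_ge (M : ℝ) (hM1 : 1 ≤ M) : 1 ≤ KM M := by
  have h := KM_den M hM1
  rw [KM, le_div_iff₀ h]
  have := Real.exp_pos (-(M + 1) / M)
  linarith

lemma aux_scalar (M : ℝ) (hM1 : 1 ≤ M) (w : ℝ) (hw : 0 ≤ w) :
    min (M + 1) (M * w) ≤ KM M * (1 - Real.exp (-w)) := by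
  have hd := KM_den M hM1
  have hM0 : 0 < M := by linarith
  have hK := KM_ge M hM1
  have hKd : KM M * (1 - Real.exp (-(M + 1) / M)) = M + 1 := by
    rw [KM, div_mul_cancel₀ _ hd.ne']
  rcases le_total w ((M + 1) / M) with h | h
  · refine (min_le_right _ _).trans ?_
    have hr0 : 0 ≤ M * w / (M + 1) := by positivity
    have hr1 : 0 ≤ 1 - M * w / (M + 1) := by
      rw [le_div_iff₀ hM0] at h
      rw [sub_nonneg, div_le_one (by linarith)]
      linarith
    have := convexOn_exp.2 (Set.mem_univ (-(M + 1) / M)) (Set.mem_univ 0) hr0 hr1 (by ring)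
    simp only [smul_eq_mul, mul_zero, add_zero, Real.exp_zero, mul_one] at this
    have e : M * w / (M + 1) * (-(M + 1) / M) = -w := by field_simp
    rw [e] at this
    calc M * w = KM M * (M * w / (M + 1) * (1 - Real.exp (-(M + 1) / M))) := by
          rw [mul_left_comm, hKd]; field_simp
      _ ≤ _ := by gcongr; linarith
  · refine (min_le_left _ _).trans ?_
    rw [← hKd]
    have : -w ≤ -(M + 1) / M := by rw [neg_div]; linarith
    gcongr

lemma aux_jensen (n : ℕ) (hn : 0 < n) (w : Fin n → ℝ) :
    ∑ j, (1 - Real.exp (-(w j))) ≤ n * (1 - Real.exp (-∑ j, w j / n)) := by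
  have hn' : (0 : ℝ) < n := by exact_mod_cast hn
  have := convexOn_exp.map_sum_le (t := Finset.univ) (w := fun _ : Fin n => (1 : ℝ) / n)
    (p := fun j => -(w j)) (fun _ _ => by positivity)
    (by simp; field_simp) (fun _ _ => Set.mem_univ _)
  simp only [smul_eq_mul, ← Finset.mul_sum] at this
  have e : 1 / (n : ℝ) * ∑ j, -w j = -∑ j, w j / n := by
    rw [Finset.sum_neg_distrib, ← Finset.sum_div]; ring
  rw [e, one_div, inv_mul_eq_div, le_div_iff₀ hn'] at this
  simp only [Finset.sum_sub_distrib, Finset.sum_const, Finset.card_univ, Fintype.card_fin,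
    nsmul_eq_mul, mul_one]
  linarith

/-- **moment inequality, general form.** If `A₁,…,Aₙ` are pairwise commuting
generators of `C₀`-semigroups with `‖Tⱼ(t)‖ ≤ M` (`M ≥ 1`), then for every `ψ ∈ 𝒯ₙ` and
every nonzero `x ∈ D(A)` (with `Aⱼ x = yⱼ`),
`‖ψ(A)x‖ ≤ -n·K_M·M^{n-1}·ψ(-‖A₁x‖/(n‖x‖), …, -‖Aₙx‖/(n‖x‖))·‖x‖`,
where `K_M = (M+1)/(1 - e^{-(M+1)/M})`. -/
theorem moment_inequality_general
    {X : Type*} [NormedAddCommGroup X] [NormedSpace ℂ X] [CompleteSpace X]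
    {n : ℕ} (hn : 0 < n) (T : Fin n → ℝ → X →L[ℂ] X) (M : ℝ) (hM1 : 1 ≤ M)
    (hT : ∀ j, IsC0Semigroup (T j)) (hM : ∀ j t, 0 ≤ t → ‖T j t‖ ≤ M)
    (hcomm : ∀ i j s t, 0 ≤ s → 0 ≤ t → T i s ∘L T j t = T j t ∘L T i s)
    (ψ : (Fin n → ℝ) → ℝ) (c₀ : ℝ) (c₁ : Fin n → ℝ) (μ : MeasureTheory.Measure (Fin n → ℝ))
    (hψ : MemTn n ψ) (hrep : HasLevyRep n ψ c₀ c₁ μ) (hcont : ContinuousOn ψ (nonposOrthant n))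
    (x : X) (hx : x ≠ 0) (y : Fin n → X) (hy : ∀ j, InGenDomain (T j) x (y j)) :
    ‖c₀ • x + (∑ j, c₁ j • y j) + ∫ u, (Tprod T u x - x) ∂μ‖ ≤
      -((n : ℝ) * KM M * M ^ (n - 1) * ψ (fun j => -‖y j‖ / (n * ‖x‖))) * ‖x‖ := by
  have hn' : (0 : ℝ) < n := by exact_mod_cast hn
  have hx' : 0 < ‖x‖ := norm_pos_iff.2 hx
  have hM0 : 0 < M := by linarith
  have hK := KM_ge M hM1
  obtain ⟨hc0, hc1, hμ, hint, hform⟩ := hrep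
  have hpw1 : (1 : ℝ) ≤ M ^ (n - 1) := one_le_pow₀ hM1
  -- pointwise bound
  have hpt : ∀ u : Fin n → ℝ, (∀ j, 0 ≤ u j) → ‖Tprod T u x - x‖ ≤
      n * KM M * M ^ (n - 1) * ‖x‖ * (1 - Real.exp (-∑ j, ‖y j‖ * u j / ‖x‖ / n)) := by
    intro u hu
    have hb : ∀ j, ‖T j (u j) x - x‖ ≤
        KM M * (1 - Real.exp (-(‖y j‖ * u j / ‖x‖))) * ‖x‖ := by
      intro j
      have hw : 0 ≤ ‖y j‖ * u j / ‖x‖ := by have := hu j; positivity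
      have h1 := aux_lip (T j) M (hT j) (hM j) x (y j) (hy j) (u j) (hu j)
      have h2 : ‖T j (u j) x - x‖ ≤ (M + 1) * ‖x‖ := by
        have := (T j (u j)).le_of_opNorm_le (hM j (u j) (hu j)) x
        have := norm_sub_le (T j (u j) x) x
        linarith
      have h3 : ‖T j (u j) x - x‖ / ‖x‖ ≤ min (M + 1) (M * (‖y j‖ * u j / ‖x‖)) := by
        refine le_min ?_ ?_
        · rwa [div_le_iff₀ hx']
        · rw [div_le_iff₀ hx']
          refine h1.trans_eq ?_
          field_simp
      exact (div_le_iff₀ hx').1 (h3.trans (aux_scalar M hM1 _ hw))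
    have h4 := aux_prod M hM1 x n (fun j => T j (u j)) _ (fun j => hM j (u j) (hu j)) hb
    have h5 : M ^ n = M * M ^ (n - 1) := by
      rw [← pow_succ']; congr 1; omega
    rw [h5, mul_assoc] at h4
    have h6 := le_of_mul_le_mul_left h4 hM0
    refine h6.trans ?_
    rw [← Finset.sum_mul, ← Finset.mul_sum]
    have h7 := aux_jensen n hn (fun j => ‖y j‖ * u j / ‖x‖)
    calc _ ≤ M ^ (n - 1) * (KM M * (n * (1 - Real.exp (-∑ j, ‖y j‖ * u j / ‖x‖ / n))) * ‖x‖) := by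
          gcongr
      _ = _ := by ring
  have hC : 1 ≤ (n : ℝ) * KM M * M ^ (n - 1) := by
    have : (1 : ℝ) ≤ n := by exact_mod_cast hn
    exact one_le_mul_of_one_le_of_one_le (one_le_mul_of_one_le_of_one_le this hK) hpw1
  have hC' : 1 ≤ KM M * M ^ (n - 1) := one_le_mul_of_one_le_of_one_le hK hpw1
  -- perturbed bound
  have heps : ∀ ε : ℝ, 0 < ε →
      ‖c₀ • x + (∑ j, c₁ j • y j) + ∫ u, (Tprod T u x - x) ∂μ‖ ≤
      -((n : ℝ) * KM M * M ^ (n - 1) * ψ (fun j => -‖y j‖ / (n * ‖x‖) - ε)) * ‖x‖ := by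
    intro ε hε
    set s : Fin n → ℝ := fun j => -‖y j‖ / (n * ‖x‖) - ε with hs
    have hsneg : s ∈ negOrthant n := by
      intro j
      have : 0 ≤ ‖y j‖ / (n * ‖x‖) := by positivity
      simp only [hs, neg_div]; linarith
    have hI := hint s hsneg
    have hI' : Integrable (fun u => n * KM M * M ^ (n - 1) * ‖x‖ *
        (1 - Real.exp (∑ j, s j * u j))) μ := by
      have := (hI.neg).const_mul (n * KM M * M ^ (n - 1) * ‖x‖)
      simpa using this
    have hae : ∀ᵐ u ∂μ, ‖Tprod T u x - x‖ ≤ n * KM M * M ^ (n - 1) * ‖x‖ *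
        (1 - Real.exp (∑ j, s j * u j)) := by
      have : ∀ᵐ u ∂μ, (∀ j, 0 ≤ u j) ∧ u ≠ 0 := hμ
      filter_upwards [this] with u hu
      refine (hpt u hu.1).trans ?_
      gcongr
      rw [← Finset.sum_neg_distrib]
      refine Finset.sum_le_sum fun j _ => ?_
      have e : s j * u j = -(‖y j‖ * u j / ‖x‖ / n) - ε * u j := by
        simp only [hs]; field_simp
      rw [e]
      have := mul_nonneg hε.le (hu.1 j)
      linarith
    have h1 := norm_integral_le_of_norm_le hI' hae
    rw [integral_const_mul] at h1
    have e1 : ∫ u, (1 - Real.exp (∑ j, s j * u j)) ∂μ =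
        -∫ u, (Real.exp (∑ j, s j * u j) - 1) ∂μ := by
      rw [← integral_neg]; congr 1; ext u; ring
    rw [e1] at h1
    have h2 : ‖c₀ • x‖ ≤ n * KM M * M ^ (n - 1) * ‖x‖ * (-c₀) := by
      rw [norm_smul, Real.norm_eq_abs, abs_of_nonpos hc0]
      have : 0 ≤ -c₀ * ‖x‖ := mul_nonneg (by linarith) hx'.le
      nlinarith
    have h3 : ‖∑ j, c₁ j • y j‖ ≤ n * KM M * M ^ (n - 1) * ‖x‖ * (-∑ j, c₁ j * s j) := by
      rw [← Finset.sum_neg_distrib, Finset.mul_sum]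
      refine norm_sum_le_of_le _ fun j _ => ?_
      rw [norm_smul, Real.norm_eq_abs, abs_of_nonneg (hc1 j)]
      have e : n * KM M * M ^ (n - 1) * ‖x‖ * (-(c₁ j * s j)) =
          KM M * M ^ (n - 1) * (c₁ j * ‖y j‖) + n * KM M * M ^ (n - 1) * ‖x‖ * (c₁ j * ε) := by
        simp only [hs]; field_simp; ring
      rw [e]
      have h0 : 0 ≤ c₁ j * ‖y j‖ := mul_nonneg (hc1 j) (norm_nonneg _)
      have h0' : 0 ≤ n * KM M * M ^ (n - 1) * ‖x‖ * (c₁ j * ε) :=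
        mul_nonneg (by positivity) (mul_nonneg (hc1 j) hε.le)
      nlinarith
    rw [hform s hsneg]
    refine (norm_add₃_le).trans ?_
    refine (add_le_add (add_le_add h2 h3) h1).trans_eq ?_
    ring
  -- pass to the limit
  have hmem : (fun j => -‖y j‖ / (n * ‖x‖)) ∈ nonposOrthant n := by
    intro j
    have : 0 ≤ ‖y j‖ / (n * ‖x‖) := by positivity
    simp only [neg_div]; linarith
  have hlim : Tendsto (fun ε : ℝ => (fun j : Fin n => -‖y j‖ / (n * ‖x‖) - ε)) (𝓝[>] 0)
      (𝓝[nonposOrthant n] (fun j => -‖y j‖ / (n * ‖x‖))) := by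
    refine tendsto_nhdsWithin_iff.2 ⟨?_, ?_⟩
    · refine tendsto_nhdsWithin_of_tendsto_nhds ?_
      have : Continuous (fun ε : ℝ => (fun j : Fin n => -‖y j‖ / (n * ‖x‖) - ε)) := by fun_prop
      simpa using this.tendsto 0
    · filter_upwards [self_mem_nhdsWithin] with ε hε j
      have h1 := hmem j
      have h2 : (0 : ℝ) < ε := hε
      simp only at h1 ⊢
      linarith
  have hψlim := (hcont _ hmem).tendsto.comp hlim
  have hfin := ((hψlim.const_mul ((n : ℝ) * KM M * M ^ (n - 1))).neg).mul_const ‖x‖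
  refine ge_of_tendsto hfin ?_
  filter_upwards [self_mem_nhdsWithin] with ε hε
  exact heps ε hε
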